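/- arXiv:2510.26652 — 2 statements merged into one kernel-verified Lean document; each statement's English description precedes it below -/
import Mathlib

section
/- Let K be a totally real number field. Then there exists a constant C > 0 such that for every integer n ≥ 2 and every finite subgroup G of GL_n(O_K), one has log|G| ≤ n·log n + C·n. -/
open scoped TensorProduct

noncomputable section

open NumberField

structure OKLattice (K : Type) [Field K] : Type 1 where
  carrier : Type
  [addCommGroup : AddCommGroup carrier]
  [module : Module (𝓞 K) carrier]
  [finite : Module.Finite (𝓞 K) carrier]
  [torsionFree : NoZeroSMulDivisors (𝓞 K) carrier]
  form : carrier →ₗ[𝓞 K] carrier →ₗ[𝓞 K] 𝓞 K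
  symm : ∀ x y, form x y = form y x
  posDef : ∀ v : carrier, v ≠ 0 → ∀ σ : K →+* ℝ, 0 < σ (algebraMap (𝓞 K) K (form v v))

attribute [instance] OKLattice.addCommGroup OKLattice.module OKLattice.finite
  OKLattice.torsionFree

namespace OKLattice

variable {K : Type} [Field K]

/-- The rank of an `O_K`-lattice: the `K`-dimension of `L ⊗ K`. -/
def rank (L : OKLattice K) : ℕ :=
  Module.finrank K (K ⊗[𝓞 K] L.carrier)

/-- `L.Represents L'` : `L'` is represented by `L`. -/
def Represents (L L' : OKLattice K) : Prop :=
  ∃ σ : L'.carrier →ₗ[𝓞 K] L.carrier, ∀ x, L.form (σ x) (σ x) = L'.form x x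

/-- `L` is `n`-universal. -/
def IsUniversal (L : OKLattice K) (n : ℕ) : Prop :=
  ∀ L' : OKLattice K, L'.rank = n → L.Represents L'

end OKLattice

/-- `U_K(n)`: the minimal rank of an `n`-universal `O_K`-lattice. -/
def minUnivRank (K : Type) [Field K] (n : ℕ) : ℕ :=
  sInf {m | ∃ L : OKLattice K, L.IsUniversal n ∧ L.rank = m}

/-- `K` is totally real: every embedding into `ℂ` has image contained in `ℝ`. -/
def TotallyReal (K : Type) [Field K] : Prop :=
  ∀ φ : K →+* ℂ, ∀ x : K, (φ x).im = 0

section Schur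

open Polynomial Module

universe v

theorem Module.End.HasEigenvalue.pow_eq_one {F V : Type*} [Field F] [AddCommGroup V] [Module F V]
    {f : End F V} {μ : F} {m : ℕ} (hμ : f.HasEigenvalue μ) (hf : f ^ m = 1) : μ ^ m = 1 := by
  obtain ⟨v, hv⟩ := hμ.exists_hasEigenvector
  have h := hv.pow_apply m
  rw [hf, End.one_apply] at h
  have h' : (μ ^ m - 1) • v = 0 := by rw [sub_smul, one_smul, ← h, sub_self]
  exact sub_eq_zero.1 ((smul_eq_zero.1 h').resolve_right hv.2)

theorem LinearMap.exists_cyclotomic_of_irreducible_dvd_charpoly {F V : Type*} [Field F] [CharZero F]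
    [AddCommGroup V] [Module F V] [FiniteDimensional F V] {p : ℕ} (hp : p.Prime)
    (hirr : ∀ j, Irreducible (cyclotomic (p ^ j) F)) {f : End F V} {k : ℕ} (hf : f ^ p ^ k = 1)
    {q : F[X]} (hq : Irreducible q) (hqm : q.Monic) (hdvd : q ∣ f.charpoly) :
    ∃ j, q = cyclotomic (p ^ j) F := by
  obtain ⟨μ, hμ⟩ := IsAlgClosed.exists_aeval_eq_zero (AlgebraicClosure F) q hq.degree_pos.ne'
  have hroot : (f.baseChange (AlgebraicClosure F)).charpoly.IsRoot μ := by
    rw [LinearMap.charpoly_baseChange, IsRoot.def, eval_map_algebraMap]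
    obtain ⟨r, hr⟩ := hdvd
    rw [hr, map_mul, hμ, zero_mul]
  have hpow : (f.baseChange (AlgebraicClosure F)) ^ p ^ k = 1 := by
    rw [← LinearMap.baseChange_pow, hf, LinearMap.baseChange_one]
  have hμk : μ ^ p ^ k = 1 :=
    ((End.hasEigenvalue_iff_isRoot_charpoly _ μ).2 hroot).pow_eq_one hpow
  obtain ⟨j, -, hj⟩ := (Nat.dvd_prime_pow hp).1 (orderOf_dvd_of_pow_eq_one hμk)
  have hprim : IsPrimitiveRoot μ (p ^ j) := hj ▸ IsPrimitiveRoot.orderOf μ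
  have hcyc : aeval μ (cyclotomic (p ^ j) F) = 0 := by
    have := hprim.isRoot_cyclotomic (pow_pos hp.pos j)
    rwa [IsRoot.def, ← map_cyclotomic (p ^ j) (algebraMap F _), eval_map_algebraMap] at this
  exact ⟨j, (minpoly.eq_of_irreducible_of_monic hq hμ hqm).trans
    (minpoly.eq_of_irreducible_of_monic (hirr j) hcyc (cyclotomic.monic _ _)).symm⟩

theorem Polynomial.exists_nextCoeff_cyclotomic_prime_pow (F : Type*) [Field F] {p : ℕ}
    (hp : p.Prime) (j : ℕ) :
    ∃ c : ℕ, (cyclotomic (p ^ j) F).nextCoeff + (cyclotomic (p ^ j) F).natDegree = (p * c : ℕ) ∧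
      c * (p - 1) ≤ (cyclotomic (p ^ j) F).natDegree ∧ (c = 0 → cyclotomic (p ^ j) F = X - 1) := by
  have hp2 := hp.two_le
  have := Fact.mk hp
  rcases j with _ | _ | j
  · refine ⟨0, ?_, by simp, by simp⟩
    rw [pow_zero, cyclotomic_one, ← C_1, nextCoeff_X_sub_C, natDegree_X_sub_C]
    simp
  · have hd : (cyclotomic p F).natDegree = p - 1 := by
      rw [natDegree_cyclotomic, Nat.totient_prime hp]
    refine ⟨1, ?_, ?_, by simp⟩
    · rw [zero_add, pow_one, nextCoeff_of_natDegree_pos (by omega), hd, cyclotomic_prime,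
        finsetSum_coeff]
      simp only [coeff_X_pow]
      rw [Finset.sum_ite_eq, if_pos (Finset.mem_range.2 (by omega)), mul_one, Nat.cast_sub (by omega)]
      simp
    · rw [zero_add, pow_one, hd, one_mul]
  · have hd : (cyclotomic (p ^ (j + 2)) F).natDegree = p * (p ^ j * (p - 1)) := by
      rw [natDegree_cyclotomic, Nat.totient_prime_pow hp (by omega), Nat.add_succ_sub_one, pow_succ']
      ring
    have hpos : 0 < p ^ j * (p - 1) := Nat.mul_pos (pow_pos hp.pos j) (by omega)
    refine ⟨p ^ j * (p - 1), ?_, ?_, fun h => absurd h hpos.ne'⟩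
    · rw [nextCoeff_of_natDegree_pos (by rw [hd]; exact Nat.mul_pos hp.pos hpos), hd,
        pow_succ p (j + 1), ← cyclotomic_expand_eq_cyclotomic hp (dvd_pow_self p j.succ_ne_zero),
        coeff_expand hp.pos, if_neg, zero_add]
      intro h
      have h1 : p ∣ 1 := by
        have := (Nat.dvd_sub_iff_right (Nat.mul_pos hp.pos hpos) (dvd_mul_right p _)).1 h
        exact this
      exact hp.one_lt.ne' (Nat.dvd_one.1 h1)
    · rw [hd, mul_comm]
      exact Nat.mul_le_mul_right _ (Nat.sub_le p 1)

theorem Polynomial.exists_nextCoeff_of_forall_irreducible_dvd {F : Type*} [Field F] {p : ℕ}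
    (hp : p.Prime) {f : F[X]} (hf : f.Monic)
    (h : ∀ q, Irreducible q → q.Monic → q ∣ f → ∃ j, q = cyclotomic (p ^ j) F) :
    ∃ c : ℕ, f.nextCoeff + f.natDegree = (p * c : ℕ) ∧ c * (p - 1) ≤ f.natDegree ∧
      (c = 0 → ∃ m, f = (X - 1) ^ m) := by
  classical
  let Q : F[X] → Prop := fun f => f.Monic ∧ ∃ c : ℕ, f.nextCoeff + f.natDegree = (p * c : ℕ) ∧
    c * (p - 1) ≤ f.natDegree ∧ (c = 0 → ∃ m, f = (X - 1) ^ m)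
  have hprod : (UniqueFactorizationMonoid.normalizedFactors f).prod = f := by
    rw [UniqueFactorizationMonoid.prod_normalizedFactors_eq hf.ne_zero, hf.normalize_eq_self]
  suffices Q f from this.2
  rw [← hprod]
  refine Multiset.prod_induction Q _ ?_ ?_ ?_
  · rintro a b ⟨ha, c, hc, hca, hc0⟩ ⟨hb, d, hd, hdb, hd0⟩
    refine ⟨ha.mul hb, c + d, ?_, ?_, ?_⟩
    · rw [ha.nextCoeff_mul hb, ha.natDegree_mul hb]
      push_cast at hc hd ⊢
      linear_combination hc + hd
    · rw [ha.natDegree_mul hb, add_mul]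
      omega
    · intro h0
      obtain ⟨m, rfl⟩ := hc0 (by omega)
      obtain ⟨m', rfl⟩ := hd0 (by omega)
      exact ⟨m + m', (pow_add _ _ _).symm⟩
  · exact ⟨monic_one, 0, by simp [nextCoeff], by simp, fun _ => ⟨0, by simp⟩⟩
  · intro q hq
    have hqi := UniqueFactorizationMonoid.irreducible_of_normalized_factor q hq
    have hqm : q.Monic := by
      rw [← UniqueFactorizationMonoid.normalize_normalized_factor q hq]
      exact monic_normalize hqi.ne_zero
    obtain ⟨j, rfl⟩ := h q hqi hqm (UniqueFactorizationMonoid.dvd_of_mem_normalizedFactors hq)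
    obtain ⟨c, h1, h2, h3⟩ := exists_nextCoeff_cyclotomic_prime_pow F hp j
    exact ⟨hqm, c, h1, h2, fun h0 => ⟨1, by rw [h3 h0, pow_one]⟩⟩

theorem LinearMap.exists_trace_add_prime_mul_eq_finrank {F V : Type*} [Field F] [CharZero F]
    [AddCommGroup V] [Module F V] [FiniteDimensional F V] {p : ℕ} (hp : p.Prime)
    (hirr : ∀ j, Irreducible (cyclotomic (p ^ j) F)) {f : End F V} {k : ℕ} (hf : f ^ p ^ k = 1) :
    ∃ c : ℕ, trace F V f + (p * c : ℕ) = finrank F V ∧ c * (p - 1) ≤ finrank F V ∧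
      (c = 0 → f = 1) := by
  obtain ⟨c, h1, h2, h3⟩ := exists_nextCoeff_of_forall_irreducible_dvd hp f.charpoly_monic
    fun q hq hqm hdvd => exists_cyclotomic_of_irreducible_dvd_charpoly hp hirr hf hq hqm hdvd
  rw [f.charpoly_natDegree] at h1 h2
  refine ⟨c, ?_, h2, fun h0 => ?_⟩
  · have htr : trace F V f = -f.charpoly.nextCoeff := by
      rw [trace_eq_matrix_trace F (Free.chooseBasis F V),
        Matrix.trace_eq_neg_charpoly_nextCoeff, charpoly_toMatrix]
    rw [← h1, htr]
    ring
  · obtain ⟨m, hm⟩ := h3 h0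
    have hsep : (X ^ p ^ k - C 1 : F[X]).Separable :=
      separable_X_pow_sub_C (1 : F) (by exact_mod_cast (pow_pos hp.pos k).ne') one_ne_zero
    have hdvd : minpoly F f ∣ X ^ p ^ k - C 1 := minpoly.dvd _ _ (by simp [hf])
    have hdvd' : minpoly F f ∣ (X - 1) ^ (m + 1) :=
      f.minpoly_dvd_charpoly.trans (hm ▸ pow_dvd_pow _ m.le_succ)
    have hX := ((hsep.squarefree.squarefree_of_dvd hdvd).dvd_pow_iff_dvd m.succ_ne_zero).1 hdvd'
    simpa [sub_eq_zero] using aeval_eq_zero_of_dvd_aeval_eq_zero hX (minpoly.aeval F f)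

theorem Representation.exists_character_eq_pow {F G : Type*} {V : Type v} [Field F] [Group G]
    [AddCommGroup V] [Module F V] [FiniteDimensional F V] (ρ : Representation F G V) (k : ℕ) :
    ∃ (W : Type v) (_ : AddCommGroup W) (_ : Module F W) (_ : FiniteDimensional F W)
      (σ : Representation F G W), σ.character = ρ.character ^ (k + 1) := by
  induction k with
  | zero => exact ⟨V, _, _, ‹_›, ρ, by simp⟩
  | succ k ih =>
    obtain ⟨W, _, _, _, σ, hσ⟩ := ih
    exact ⟨TensorProduct F W V, _, _, inferInstance, σ.tprod ρ, by
      rw [Representation.char_tensor, hσ, ← pow_succ]⟩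

theorem Representation.exists_sum_character_pow_eq {F G V : Type*} [Field F] [CharZero F] [Group G]
    [Fintype G] [AddCommGroup V] [Module F V] [FiniteDimensional F V] (ρ : Representation F G V)
    (k : ℕ) : ∃ m : ℕ, ∑ g, ρ.character g ^ k = Nat.card G * m := by
  rcases k with _ | k
  · exact ⟨1, by simp⟩
  obtain ⟨W, _, _, _, σ, hσ⟩ := ρ.exists_character_eq_pow k
  have h0 : (Nat.card G : F) ≠ 0 := by exact_mod_cast Nat.card_pos.ne'
  have := invertibleOfNonzero h0
  refine ⟨finrank F σ.invariants, ?_⟩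
  rw [← σ.card_inv_mul_sum_char_eq_finrank, mul_inv_cancel_left₀ h0, hσ]
  rfl

theorem Representation.exists_sum_aeval_character_eq {F G V : Type*} [Field F] [CharZero F]
    [Group G] [Fintype G] [AddCommGroup V] [Module F V] [FiniteDimensional F V]
    (ρ : Representation F G V) (f : ℤ[X]) :
    ∃ m : ℤ, ∑ g, aeval (ρ.character g) f = Nat.card G * m := by
  choose m hm using ρ.exists_sum_character_pow_eq
  refine ⟨∑ i ∈ Finset.range (f.natDegree + 1), f.coeff i * m i, ?_⟩
  simp_rw [aeval_eq_sum_range]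
  rw [Finset.sum_comm]
  simp_rw [← Finset.smul_sum, hm]
  push_cast
  rw [Finset.mul_sum]
  exact Finset.sum_congr rfl fun i _ => by rw [zsmul_eq_mul]; ring

/-- **Schur's bound**: the order of a finite `p`-group with a faithful representation over a field
over which all `p`-power cyclotomic polynomials are irreducible. -/
theorem IsPGroup.card_dvd_of_injective_representation {F G V : Type*} [Field F] [CharZero F]
    [Group G] [Finite G] [AddCommGroup V] [Module F V] [FiniteDimensional F V] {p : ℕ}
    (hp : p.Prime) (hirr : ∀ j, Irreducible (cyclotomic (p ^ j) F)) (hG : IsPGroup p G)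
    (ρ : Representation F G V) (hρ : Function.Injective ρ) :
    Nat.card G ∣ p ^ (finrank F V / (p - 1)) * (finrank F V / (p - 1)).factorial := by
  have := Fintype.ofFinite G
  classical
  set n := finrank F V
  set N := n / (p - 1)
  let f : ℤ[X] := ∏ j ∈ Finset.range N, (X - C ((n : ℤ) - p * (j + 1 : ℕ)))
  have hf (x : F) : aeval x f = ∏ j ∈ Finset.range N, (x - (n - p * (j + 1 : ℕ))) := by
    simp [f, map_prod]
  have hone : aeval (ρ.character 1) f = (p ^ N * N.factorial : ℕ) := by
    rw [hf, ρ.char_one, ← Finset.prod_range_add_one_eq_factorial]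
    simp only [n, sub_sub_cancel, Finset.prod_mul_distrib, Finset.prod_const, Finset.card_range]
    push_cast
    rfl
  have hne (g : G) (hg : g ≠ 1) : aeval (ρ.character g) f = 0 := by
    obtain ⟨k, hk⟩ := hG g
    obtain ⟨c, hc, hcn, hc0⟩ := LinearMap.exists_trace_add_prime_mul_eq_finrank hp hirr
      (f := ρ g) (k := k) (by rw [← map_pow, hk, map_one])
    have hcpos : c ≠ 0 := fun h => hg (hρ (by rw [hc0 h, map_one]))
    have hcN : c ≤ N := (Nat.le_div_iff_mul_le (Nat.sub_pos_of_lt hp.one_lt)).2 hcn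
    rw [hf]
    refine Finset.prod_eq_zero (Finset.mem_range.2 (show c - 1 < N by omega)) ?_
    rw [Nat.sub_add_cancel (Nat.one_le_iff_ne_zero.2 hcpos), Representation.character]
    push_cast at hc
    linear_combination hc
  obtain ⟨m, hm⟩ := ρ.exists_sum_aeval_character_eq f
  rw [Finset.sum_eq_single 1 (fun g _ hg => hne g hg) (by simp), hone] at hm
  exact Int.natCast_dvd_natCast.1 ⟨m, by exact_mod_cast hm⟩

theorem Nat.factorization_pow_mul_factorial_self_mul_le {p : ℕ} (hp : p.Prime) (N : ℕ) :
    (p - 1) * (p ^ N * N.factorial).factorization p ≤ (p - 1) * N + N := by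
  have := Fact.mk hp
  rw [Nat.factorization_mul (pow_ne_zero _ hp.ne_zero) N.factorial_ne_zero, Finsupp.add_apply,
    hp.factorization_pow, Finsupp.single_eq_same, mul_add, Nat.factorization_def _ hp,
    sub_one_mul_padicValNat_factorial]
  omega

theorem sub_one_mul_factorization_card_le {F G V : Type*} [Field F] [CharZero F]
    [Group G] [Finite G] [AddCommGroup V] [Module F V] [FiniteDimensional F V] {p : ℕ}
    (hp : p.Prime) (hirr : ∀ j, Irreducible (cyclotomic (p ^ j) F))
    (ρ : Representation F G V) (hρ : Function.Injective ρ) :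
    (p - 1) * (Nat.card G).factorization p ≤ p * (finrank F V / (p - 1)) := by
  have := Fact.mk hp
  set N := finrank F V / (p - 1)
  obtain ⟨P⟩ : Nonempty (Sylow p G) := inferInstance
  have hdvd := IsPGroup.card_dvd_of_injective_representation hp hirr P.isPGroup'
    (ρ.comp (P : Subgroup G).subtype) (hρ.comp Subtype.val_injective)
  rw [P.card_eq_multiplicity, hp.pow_dvd_iff_le_factorization
    (mul_ne_zero (pow_ne_zero _ hp.ne_zero) (Nat.factorial_ne_zero _))] at hdvd
  refine (Nat.mul_le_mul_left _ hdvd).trans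
    ((Nat.factorization_pow_mul_factorial_self_mul_le hp N).trans_eq ?_)
  rw [← Nat.succ_mul, Nat.succ_eq_add_one, Nat.sub_add_cancel hp.one_le]

theorem Polynomial.irreducible_cyclotomic_prime_pow_of_notMem_sq {R K : Type*} [CommRing R]
    [IsDomain R] [IsIntegrallyClosed R] [Field K] [Algebra R K] [IsFractionRing R K] {p : ℕ}
    (hp : p.Prime) {P : Ideal R} (hP : P.IsPrime) (hmem : (p : R) ∈ P) (hsq : (p : R) ∉ P ^ 2)
    (j : ℕ) : Irreducible (cyclotomic (p ^ j) K) := by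
  have := Fact.mk hp
  rcases j with _ | j
  · rw [pow_zero, cyclotomic_one, ← C_1]
    exact irreducible_X_sub_C 1
  have hE := cyclotomic_prime_pow_comp_X_add_one_isEisensteinAt p j
  have hXm : (X + 1 : R[X]).Monic := by rw [← C_1]; exact monic_X_add_C 1
  have hXd : (X + 1 : R[X]).natDegree = 1 := by rw [← C_1]; exact natDegree_X_add_C 1
  have hmap : ((cyclotomic (p ^ (j + 1)) ℤ).comp (X + 1)).map (Int.castRingHom R) =
      (cyclotomic (p ^ (j + 1)) R).comp (X + 1) := by
    simp [map_comp]
  have hmonic : ((cyclotomic (p ^ (j + 1)) R).comp (X + 1)).Monic :=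
    (cyclotomic.monic _ R).comp hXm (by simp [hXd])
  have hmonicZ : ((cyclotomic (p ^ (j + 1)) ℤ).comp (X + 1)).Monic :=
    (cyclotomic.monic _ ℤ).comp (by rw [← C_1]; exact monic_X_add_C 1)
      (by rw [← C_1, natDegree_X_add_C]; exact one_ne_zero)
  have hdeg : ((cyclotomic (p ^ (j + 1)) R).comp (X + 1)).natDegree =
      ((cyclotomic (p ^ (j + 1)) ℤ).comp (X + 1)).natDegree := by
    rw [← hmap, hmonicZ.natDegree_map]
  have hEis : ((cyclotomic (p ^ (j + 1)) R).comp (X + 1)).IsEisensteinAt P := by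
    refine hmonic.isEisensteinAt_of_mem_of_notMem hP.ne_top (fun {i} hi => ?_) ?_
    · rw [← hmap, coeff_map]
      obtain ⟨c, hc⟩ := Ideal.mem_span_singleton.1 (hE.mem (hdeg ▸ hi))
      rw [hc]
      simpa using P.mul_mem_right _ hmem
    · rw [coeff_zero_eq_eval_zero, eval_comp, eval_add, eval_X, eval_one, zero_add,
        eval_one_cyclotomic_prime_pow]
      exact hsq
  have hirr := hEis.irreducible hP hmonic.isPrimitive (by
    rw [natDegree_comp, hXd, mul_one]
    exact natDegree_cyclotomic (p ^ (j + 1)) R ▸ Nat.totient_pos.2 (pow_pos hp.pos _))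
  have hirr' : Irreducible (cyclotomic (p ^ (j + 1)) R) := by
    have h := MulEquiv.irreducible_iff (algEquivAevalXAddC (1 : R))
      (x := cyclotomic (p ^ (j + 1)) R)
    refine h.1 ?_
    rw [algEquivAevalXAddC_apply]
    simpa [comp, aeval_def] using hirr
  rw [← map_cyclotomic _ (algebraMap R K)]
  exact ((cyclotomic.monic _ R).irreducible_iff_irreducible_map_fraction_map).1 hirr'

open NumberField in
theorem NumberField.irreducible_cyclotomic_prime_pow_of_not_dvd_discr (K : Type*) [Field K]
    [NumberField K] {p : ℕ} (hp : p.Prime) (hd : ¬ (p : ℤ) ∣ discr K) (j : ℕ) :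
    Irreducible (cyclotomic (p ^ j) K) := by
  have hpZ := Nat.prime_iff_prime_int.1 hp
  have hmax : (Ideal.span {(p : ℤ)}).IsMaximal :=
    PrincipalIdealRing.isMaximal_of_irreducible hpZ.irreducible
  obtain ⟨P, hP, hlies⟩ :=
    Ideal.exists_maximal_ideal_liesOver_of_isIntegral (S := 𝓞 K) (Ideal.span {(p : ℤ)})
  have hmem : (p : 𝓞 K) ∈ P := by
    simpa using hlies.over.le (Ideal.mem_span_singleton_self (p : ℤ))
  refine irreducible_cyclotomic_prime_pow_of_notMem_sq (R := 𝓞 K) hp hP.isPrime hmem ?_ j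
  intro hsq
  have hunr := (not_dvd_discr_iff_forall_mem K (𝓞 K) hpZ).1 hd P hP.isPrime (by simpa using hmem)
  have h := pow_sub_one_dvd_differentIdeal ℤ (p := Ideal.span {(p : ℤ)}) P 2
    (by simpa using hp.ne_zero) (by
      rw [Ideal.dvd_iff_le, Ideal.map_span, Ideal.span_le]
      simpa using hsq)
  exact not_dvd_differentIdeal_iff.2 hunr (by simpa using h)

/-- The faithful action of invertible matrices over a domain on vectors over a field extension,
regarded as a representation over a subfield. -/
def Matrix.GeneralLinearGroup.vecRepresentation (F : Type*) {R K ι : Type*} [Fintype ι]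
    [DecidableEq ι] [CommRing R] [Field F] [Field K] [Algebra R K] [Algebra F K] :
    Representation F (GL ι R) (ι → K) where
  toFun g := (Matrix.toLin' ((g : Matrix ι ι R).map (algebraMap R K))).restrictScalars F
  map_one' := by
    ext
    simp [Matrix.map_one]
  map_mul' g h := by
    ext
    simp [Matrix.map_mul]

theorem Matrix.GeneralLinearGroup.vecRepresentation_injective (F : Type*) {R K ι : Type*}
    [Fintype ι] [DecidableEq ι] [CommRing R] [Field F] [Field K] [Algebra R K] [Algebra F K]
    (hRK : Function.Injective (algebraMap R K)) :
    Function.Injective (vecRepresentation F : Representation F (GL ι R) (ι → K)) := by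
  intro g h hgh
  have h1 := LinearMap.restrictScalars_injective F hgh
  exact Units.ext (Matrix.map_injective hRK (Matrix.toLin'.injective h1))

section Bounds

open NumberField

variable (K : Type*) [Field K] [NumberField K] {n p : ℕ} (G : Subgroup (GL (Fin n) (𝓞 K)))
  [Finite G]

theorem sub_one_mul_factorization_card_subgroup_GL_le (hp : p.Prime)
    (hd : ¬ (p : ℤ) ∣ discr K) :
    (p - 1) * (Nat.card G).factorization p ≤ p * (n / (p - 1)) := by
  have h := sub_one_mul_factorization_card_le hp
    (irreducible_cyclotomic_prime_pow_of_not_dvd_discr K hp hd)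
    ((Matrix.GeneralLinearGroup.vecRepresentation K :
      Representation K (GL (Fin n) (𝓞 K)) (Fin n → K)).comp G.subtype)
    ((Matrix.GeneralLinearGroup.vecRepresentation_injective K
      RingOfIntegers.coe_injective).comp Subtype.val_injective)
  rwa [finrank_fin_fun] at h

theorem factorization_card_subgroup_GL_le (hp : p.Prime) :
    (Nat.card G).factorization p ≤ 2 * (n * finrank ℚ K) := by
  have h := sub_one_mul_factorization_card_le hp
    (fun j => cyclotomic.irreducible_rat (pow_pos hp.pos j))
    ((Matrix.GeneralLinearGroup.vecRepresentation ℚ :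
      Representation ℚ (GL (Fin n) (𝓞 K)) (Fin n → K)).comp G.subtype)
    ((Matrix.GeneralLinearGroup.vecRepresentation_injective ℚ
      RingOfIntegers.coe_injective).comp Subtype.val_injective)
  rw [finrank_pi_fintype, Finset.sum_const, Finset.card_univ, Fintype.card_fin, smul_eq_mul] at h
  have hp2 := hp.two_le
  set m := n * finrank ℚ K
  refine Nat.le_of_mul_le_mul_left (c := p - 1) ?_ (by omega)
  calc _ ≤ p * (m / (p - 1)) := h
    _ ≤ (2 * (p - 1)) * m := Nat.mul_le_mul (by omega) (Nat.div_le_self _ _)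
    _ = _ := by ring

end Bounds

theorem Nat.Prime.div_le_factorization_factorial {p : ℕ} (hp : p.Prime) (n : ℕ) :
    n / p ≤ n.factorial.factorization p := by
  have := Fact.mk hp
  rw [Nat.factorization_def _ hp, padicValNat_factorial (lt_add_of_pos_right _ one_pos)]
  by_cases hn : n < p
  · simp [Nat.div_eq_of_lt hn]
  · have h1 : 1 ≤ Nat.log p n := Nat.log_pos hp.one_lt (not_lt.1 hn)
    simpa using Finset.single_le_sum (f := fun i => n / p ^ i) (fun _ _ => Nat.zero_le _)
      (Finset.mem_Ico.2 ⟨le_rfl, Nat.lt_succ_of_le h1⟩)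

theorem cast_le_factorization_factorial_add {p n v : ℕ} (hp : p.Prime)
    (h : (p - 1) * v ≤ p * (n / (p - 1))) :
    (v : ℝ) ≤ n.factorial.factorization p + 1 + 2 * n / ((p : ℝ) - 1) ^ 2 := by
  have hp2 : (2 : ℝ) ≤ p := by exact_mod_cast hp.two_le
  have hp0 : (0 : ℝ) < p - 1 := by linarith
  have hN : ((n / (p - 1) : ℕ) : ℝ) ≤ n / (p - 1) := by
    simpa [Nat.cast_sub hp.one_le] using Nat.cast_div_le (α := ℝ) (m := n) (n := p - 1)
  have hv : ((p : ℝ) - 1) * v ≤ p * (n / (p - 1)) := by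
    have h' : (((p - 1) * v : ℕ) : ℝ) ≤ (p * (n / (p - 1)) : ℕ) := by exact_mod_cast h
    rw [Nat.cast_mul, Nat.cast_mul, Nat.cast_sub hp.one_le, Nat.cast_one] at h'
    exact h'.trans (mul_le_mul_of_nonneg_left hN (by linarith))
  have hfl : (n : ℝ) / p ≤ n.factorial.factorization p + 1 := by
    have h1 : (n : ℝ) / p < (n / p : ℕ) + 1 := by
      rw [← Nat.floor_div_eq_div (K := ℝ)]
      exact Nat.lt_floor_add_one _
    have h2 : ((n / p : ℕ) : ℝ) ≤ n.factorial.factorization p := by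
      exact_mod_cast hp.div_le_factorization_factorial n
    linarith
  have hn : (0 : ℝ) ≤ n := Nat.cast_nonneg n
  have hv' : (v : ℝ) ≤ n / p + 2 * n / ((p : ℝ) - 1) ^ 2 := by
    refine le_of_mul_le_mul_left (hv.trans ?_) hp0
    rw [← sub_nonneg]
    have : ((p : ℝ) - 1) * (n / p + 2 * n / ((p : ℝ) - 1) ^ 2) - p * (n / (p - 1)) =
        n / (p * (p - 1)) := by
      field_simp
      ring
    rw [this]
    positivity
  linarith

theorem Real.summable_log_div_sub_one_sq :
    Summable fun m : ℕ => Real.log m / ((m : ℝ) - 1) ^ 2 := by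
  have hs : Summable fun m : ℕ => 8 * (1 / (m : ℝ) ^ (3 / 2 : ℝ)) :=
    (Real.summable_one_div_nat_rpow.2 (by norm_num)).mul_left 8
  refine hs.of_nonneg_of_le (fun m => div_nonneg (Real.log_natCast_nonneg m) (sq_nonneg _))
    fun m => ?_
  rcases lt_or_ge m 2 with hm | hm
  · have : Real.log m = 0 := by interval_cases m <;> simp
    rw [this, zero_div]
    positivity
  have hm2 : (2 : ℝ) ≤ m := by exact_mod_cast hm
  have hm0 : (0 : ℝ) < m := by linarith
  have hlog : Real.log m ≤ 2 * (m : ℝ) ^ (1 / 2 : ℝ) :=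
    (Real.log_le_rpow_div (ε := 1 / 2) hm0.le (by norm_num)).trans_eq (by ring)
  have hsq : (m : ℝ) ^ 2 / 4 ≤ ((m : ℝ) - 1) ^ 2 := by nlinarith
  calc Real.log m / ((m : ℝ) - 1) ^ 2
      ≤ 2 * (m : ℝ) ^ (1 / 2 : ℝ) / ((m : ℝ) ^ 2 / 4) := by gcongr
    _ = 8 * (1 / (m : ℝ) ^ (3 / 2 : ℝ)) := by
      have h2 : (m : ℝ) ^ 2 = (m : ℝ) ^ (1 / 2 : ℝ) * (m : ℝ) ^ (3 / 2 : ℝ) := by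
        rw [← Real.rpow_add hm0, ← Real.rpow_natCast]
        norm_num
      rw [h2]
      field_simp
      norm_num

theorem Real.sum_factorization_factorial_mul_log_le (n : ℕ) (s : Finset ℕ) :
    ∑ p ∈ s, n.factorial.factorization p * Real.log p ≤ n * Real.log n := by
  calc ∑ p ∈ s, n.factorial.factorization p * Real.log p
      ≤ Real.log n.factorial := by
        rw [Real.log_nat_eq_sum_factorization, Finsupp.sum]
        rw [← Finset.sum_filter_of_ne (p := (· ∈ n.factorial.factorization.support))]
        · exact Finset.sum_le_sum_of_subset_of_nonneg (fun p hp => (Finset.mem_filter.1 hp).2)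
            fun p _ _ => mul_nonneg (Nat.cast_nonneg _) (Real.log_natCast_nonneg p)
        · intro p _ hp
          rw [Finsupp.mem_support_iff]
          exact fun h => hp (by simp [h])
    _ ≤ Real.log ((n : ℝ) ^ n) := by
        refine Real.log_le_log (by exact_mod_cast n.factorial_pos) ?_
        exact_mod_cast n.factorial_le_pow
    _ = n * Real.log n := Real.log_pow _ _

theorem Real.sum_log_prime_le {n : ℕ} (hn : 1 ≤ n) :
    ∑ p ∈ (Finset.range (n + 2)).filter Nat.Prime, Real.log p ≤ 2 * Real.log 4 * n := by
  have h := Chebyshev.theta_le_log4_mul_x (x := (n + 1 : ℕ)) (Nat.cast_nonneg _)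
  have hs : (Finset.range (n + 2)).filter Nat.Prime =
      (Finset.Ioc 0 (n + 1)).filter Nat.Prime := by
    ext p
    simp only [Finset.mem_filter, Finset.mem_range, Finset.mem_Ioc]
    exact ⟨fun h => ⟨⟨h.2.pos, by omega⟩, h.2⟩, fun h => ⟨by omega, h.2⟩⟩
  rw [Chebyshev.theta, Nat.floor_natCast] at h
  rw [hs]
  refine h.trans ?_
  have hn' : (1 : ℝ) ≤ n := by exact_mod_cast hn
  have := Real.log_pos (show (1 : ℝ) < 4 by norm_num)
  push_cast
  nlinarith

theorem log_card_subgroup_GL_le (K : Type*) [Field K] [NumberField K] {n : ℕ} (hn : 1 ≤ n)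
    (G : Subgroup (GL (Fin n) (NumberField.RingOfIntegers K))) [Finite G] :
    Real.log (Nat.card G) ≤ n * Real.log n + (2 * Real.log 4 +
      2 * (∑' m : ℕ, Real.log m / ((m : ℝ) - 1) ^ 2) + 2 * finrank ℚ K *
        ∑ p ∈ (NumberField.discr K).natAbs.primeFactors, Real.log p) * n := by
  classical
  set B := (NumberField.discr K).natAbs.primeFactors
  set S := (Finset.range (n + 2)).filter Nat.Prime
  have hlog (p : ℕ) : 0 ≤ Real.log p := Real.log_natCast_nonneg p
  have hbad : ∑ p ∈ (Nat.card G).primeFactors.filter (· ∈ B),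
      (Nat.card G).factorization p * Real.log p ≤
      ∑ p ∈ B, (2 * (n * finrank ℚ K) : ℕ) * Real.log p := by
    refine (Finset.sum_le_sum fun p hp => mul_le_mul_of_nonneg_right (Nat.cast_le.2
      (factorization_card_subgroup_GL_le K G (Nat.prime_of_mem_primeFactors
        (Finset.mem_filter.1 hp).1))) (hlog p)).trans ?_
    exact Finset.sum_le_sum_of_subset_of_nonneg (fun p hp => (Finset.mem_filter.1 hp).2)
      fun p _ _ => mul_nonneg (Nat.cast_nonneg _) (hlog p)
  have hgood : ∑ p ∈ (Nat.card G).primeFactors.filter (· ∉ B),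
      (Nat.card G).factorization p * Real.log p ≤
      ∑ p ∈ S, (n.factorial.factorization p + 1 + 2 * n / ((p : ℝ) - 1) ^ 2) * Real.log p := by
    have hbound {p : ℕ} (hp : p ∈ (Nat.card G).primeFactors.filter (· ∉ B)) :
        (p - 1) * (Nat.card G).factorization p ≤ p * (n / (p - 1)) := by
      obtain ⟨hpG, hpB⟩ := Finset.mem_filter.1 hp
      have hpp := Nat.prime_of_mem_primeFactors hpG
      refine sub_one_mul_factorization_card_subgroup_GL_le K G hpp fun hd => hpB ?_
      exact Nat.mem_primeFactors.2 ⟨hpp, Int.natCast_dvd.1 hd,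
        Int.natAbs_ne_zero.2 (NumberField.discr_ne_zero K)⟩
    refine (Finset.sum_le_sum fun p hp => mul_le_mul_of_nonneg_right
      (cast_le_factorization_factorial_add (Nat.prime_of_mem_primeFactors
        (Finset.mem_filter.1 hp).1) (hbound hp)) (hlog p)).trans ?_
    refine Finset.sum_le_sum_of_subset_of_nonneg (fun p hp => ?_)
      fun p _ _ => mul_nonneg (by positivity) (hlog p)
    have hpG := (Finset.mem_filter.1 hp).1
    have hpp := Nat.prime_of_mem_primeFactors hpG
    refine Finset.mem_filter.2 ⟨Finset.mem_range.2 ?_, hpp⟩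
    by_contra hlt
    have h := hbound hp
    rw [Nat.div_eq_of_lt (by omega), mul_zero] at h
    have hpos := hpp.factorization_pos_of_dvd Nat.card_pos.ne' (Nat.dvd_of_mem_primeFactors hpG)
    exact absurd (Nat.mul_pos (Nat.sub_pos_of_lt hpp.one_lt) hpos) (by omega)
  have hsplit : ∑ p ∈ S, (n.factorial.factorization p + 1 + 2 * n / ((p : ℝ) - 1) ^ 2) *
      Real.log p = ∑ p ∈ S, n.factorial.factorization p * Real.log p + ∑ p ∈ S, Real.log p +
        2 * n * ∑ p ∈ S, Real.log p / ((p : ℝ) - 1) ^ 2 := by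
    rw [Finset.mul_sum, ← Finset.sum_add_distrib, ← Finset.sum_add_distrib]
    exact Finset.sum_congr rfl fun p _ => by ring
  have hsum : ∑ p ∈ S, Real.log p / ((p : ℝ) - 1) ^ 2 ≤
      ∑' m : ℕ, Real.log m / ((m : ℝ) - 1) ^ 2 :=
    Real.summable_log_div_sub_one_sq.sum_le_tsum _ fun p _ => div_nonneg (hlog p) (sq_nonneg _)
  have hfact := Real.sum_factorization_factorial_mul_log_le n S
  have htheta := Real.sum_log_prime_le hn
  rw [Real.log_nat_eq_sum_factorization, Finsupp.sum, Nat.support_factorization,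
    ← Finset.sum_filter_add_sum_filter_not _ (· ∈ B)]
  rw [← Finset.mul_sum] at hbad
  rw [hsplit] at hgood
  have hn0 : (0 : ℝ) ≤ 2 * n := by positivity
  have hsum' := mul_le_mul_of_nonneg_left hsum hn0
  push_cast at hbad
  linarith

end Schur

theorem stmt15 (K : Type) [Field K] [NumberField K] (htr : TotallyReal K) :
    ∃ C : ℝ, 0 < C ∧ ∀ n : ℕ, 2 ≤ n → ∀ G : Subgroup (GL (Fin n) (𝓞 K)),
      Finite G → Real.log (Nat.card G) ≤ n * Real.log n + C * n := by
  refine ⟨_, ?_, fun n hn G _ => log_card_subgroup_GL_le K (by omega) G⟩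
  have h4 := Real.log_pos (show (1 : ℝ) < 4 by norm_num)
  have hsum : 0 ≤ ∑' m : ℕ, Real.log m / ((m : ℝ) - 1) ^ 2 :=
    tsum_nonneg fun m => div_nonneg (Real.log_natCast_nonneg m) (sq_nonneg _)
  have hB : 0 ≤ ∑ p ∈ (discr K).natAbs.primeFactors, Real.log p :=
    Finset.sum_nonneg fun p _ => Real.log_natCast_nonneg p
  positivity
end
end

section
/- Let K be a totally real number field and let 𝔭 be a dyadic maximal ideal of O_K. Let e = ord_𝔭(2) be the ramification index and let f be the inertia degree, so that the residue field O_K/𝔭 has 2^f elements. For an integer v ≥ 1, let H_v be the subgroup of the unit group O_𝔭^× generated by the squares of units together with all units congruent to 1 modulo 𝔭^v·O_𝔭. Then the index [O_𝔭^× : H_v] equals 2^{⌊v/2⌋·f} if v ≤ 2e, and equals 2^{e·f + 1} if v > 2e. -/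
open NumberField IsDedekindDomain

noncomputable section

open IsLocalRing

section UnitFiltration

variable {R : Type*} [CommRing R]

/-- The subgroup of units congruent to `1` modulo `π ^ n`. -/
def higherUnits (π : R) (n : ℕ) : Subgroup Rˣ :=
  (Units.map (Ideal.Quotient.mk (Ideal.span {π ^ n})).toMonoidHom).ker

theorem mem_higherUnits {π : R} {n : ℕ} {u : Rˣ} :
    u ∈ higherUnits π n ↔ π ^ n ∣ (u : R) - 1 := by
  rw [higherUnits, MonoidHom.mem_ker, ← Ideal.mem_span_singleton, ← Ideal.Quotient.eq, Units.ext_iff]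
  simp

theorem higherUnits_succ_le (π : R) (n : ℕ) : higherUnits π (n + 1) ≤ higherUnits π n :=
  fun _ hu => mem_higherUnits.2 ((pow_dvd_pow π n.le_succ).trans (mem_higherUnits.1 hu))

variable (R) in
/-- The subgroup of squares of units. -/
def squareUnits : Subgroup Rˣ := (powMonoidHom 2 : Rˣ →* Rˣ).range

theorem index_squareUnits_sup_higherUnits_succ (π : R) (n : ℕ) :
    (squareUnits R ⊔ higherUnits π (n + 1)).index =
      (squareUnits R ⊔ higherUnits π (n + 1)).relIndex (higherUnits π n) *
        (squareUnits R ⊔ higherUnits π n).index := by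
  have hle := higherUnits_succ_le π n
  rw [← Subgroup.relIndex_mul_index (sup_le_sup_left hle (squareUnits R))]
  congr 1
  rw [← Subgroup.relIndex_sup_left (H := higherUnits π n), sup_assoc, sup_eq_right.2 hle]

variable [IsDomain R]

/-- If `2` is associated to `π ^ e`, then `d ^ 2 + 2 * d` has small valuation unless `d` has
large valuation. -/
theorem Prime.pow_succ_dvd_of_dvd_sq_add {π w : R} {e : ℕ} (hπ : Prime π)
    (h2 : (2 : R) = w * π ^ e) {d : R} {j : ℕ} (hj : j < e)
    (hd : π ^ (2 * j + 1) ∣ d ^ 2 + 2 * d) : π ^ (j + 1) ∣ d := by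
  induction j with
  | zero =>
    obtain ⟨e, rfl⟩ := Nat.exists_eq_add_of_lt hj
    have : π ∣ d ^ 2 := by
      rw [← dvd_add_left (c := 2 * d) (by rw [h2]; exact ⟨w * π ^ e * d, by ring⟩)]
      simpa using hd
    simpa using hπ.dvd_of_dvd_pow this
  | succ j ih =>
    obtain ⟨a, rfl⟩ := ih (by omega) ((pow_dvd_pow π (by omega)).trans hd)
    obtain ⟨e, rfl⟩ := Nat.exists_eq_add_of_lt hj
    have h : π ^ (2 * (j + 1)) * π ∣ π ^ (2 * (j + 1)) * (a ^ 2 + π * (w * π ^ e * a)) := by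
      rw [← pow_succ]
      convert hd using 1
      rw [h2]; ring
    have ha := (dvd_add_left (dvd_mul_right π _)).1
      ((mul_dvd_mul_iff_left (pow_ne_zero _ hπ.ne_zero)).1 h)
    rw [pow_succ]
    exact mul_dvd_mul_left _ (hπ.dvd_of_dvd_pow ha)

variable [IsDiscreteValuationRing R] {π : R}

theorem Irreducible.residue_eq_zero_iff_dvd (hπ : Irreducible π) {x : R} :
    residue R x = 0 ↔ π ∣ x := by
  rw [residue_eq_zero_iff, hπ.maximalIdeal_eq, Ideal.mem_span_singleton]

theorem Irreducible.isUnit_one_add_pow_mul (hπ : Irreducible π) {n : ℕ} (hn : n ≠ 0) (x : R) :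
    IsUnit (1 + π ^ n * x) := by
  rw [← residue_ne_zero_iff_isUnit, map_add,
    hπ.residue_eq_zero_iff_dvd.2 ((dvd_pow_self π hn).mul_right x)]
  simp

theorem Irreducible.residue_eq_of_pow_mul_eq (hπ : Irreducible π) {n : ℕ} {c d : R}
    (h : π ^ n * c = π ^ n * d) : residue R c = residue R d := by
  rw [mul_left_cancel₀ (pow_ne_zero _ hπ.ne_zero) h]

/-- The homomorphism `1 + π ^ n * c ↦ c mod π` on the `n`-th unit group, for `n ≠ 0`. -/
def higherUnitsResidue (hπ : Irreducible π) {n : ℕ} (hn : n ≠ 0) :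
    higherUnits π n →* Multiplicative (ResidueField R) where
  toFun u := .ofAdd (residue R (mem_higherUnits.1 u.2).choose)
  map_one' := by
    rw [ofAdd_eq_one]
    have h := (mem_higherUnits.1 (1 : higherUnits π n).2).choose_spec
    rw [hπ.residue_eq_of_pow_mul_eq (d := 0) (by rw [← h]; simp), map_zero]
  map_mul' u v := by
    have hu := (mem_higherUnits.1 u.2).choose_spec
    have hv := (mem_higherUnits.1 v.2).choose_spec
    have huv := (mem_higherUnits.1 (u * v).2).choose_spec
    set a := (mem_higherUnits.1 u.2).choose
    set b := (mem_higherUnits.1 v.2).choose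
    rw [← ofAdd_add, hπ.residue_eq_of_pow_mul_eq (d := a + b + π ^ n * (a * b)) (by
      rw [← huv, Subgroup.coe_mul, Units.val_mul]
      linear_combination ((v : Rˣ) : R) * hu + (1 + π ^ n * a) * hv),
      map_add (residue R), map_add (residue R),
      hπ.residue_eq_zero_iff_dvd.2 ((dvd_pow_self π hn).mul_right (a * b)), add_zero]

theorem higherUnitsResidue_apply (hπ : Irreducible π) {n : ℕ} (hn : n ≠ 0) {u : higherUnits π n}
    {c : R} (h : ((u : Rˣ) : R) = 1 + π ^ n * c) :
    higherUnitsResidue hπ hn u = .ofAdd (residue R c) :=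
  congrArg Multiplicative.ofAdd (hπ.residue_eq_of_pow_mul_eq
    (by rw [← (mem_higherUnits.1 u.2).choose_spec, h, add_sub_cancel_left]))

theorem higherUnitsResidue_surjective (hπ : Irreducible π) {n : ℕ} (hn : n ≠ 0) :
    Function.Surjective (higherUnitsResidue hπ hn) := by
  intro c
  obtain ⟨c, rfl⟩ := Multiplicative.ofAdd.surjective c
  obtain ⟨c, rfl⟩ := residue_surjective c
  obtain ⟨u, hu⟩ := hπ.isUnit_one_add_pow_mul hn c
  exact ⟨⟨u, mem_higherUnits.2 ⟨c, by rw [hu]; ring⟩⟩, higherUnitsResidue_apply hπ hn hu⟩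

theorem higherUnitsResidue_ker (hπ : Irreducible π) {n : ℕ} (hn : n ≠ 0) :
    (higherUnitsResidue hπ hn).ker = (higherUnits π (n + 1)).subgroupOf (higherUnits π n) := by
  ext u
  obtain ⟨c, hc⟩ := mem_higherUnits.1 u.2
  rw [MonoidHom.mem_ker, higherUnitsResidue_apply hπ hn (sub_eq_iff_eq_add'.1 hc), ofAdd_eq_one,
    hπ.residue_eq_zero_iff_dvd, Subgroup.mem_subgroupOf, mem_higherUnits, hc, pow_succ,
    mul_dvd_mul_iff_left (pow_ne_zero _ hπ.ne_zero)]

/-- The residues `c` of those elements with `1 + π ^ n * c` a square. -/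
def squareResidues (hπ : Irreducible π) {n : ℕ} (hn : n ≠ 0) :
    Subgroup (Multiplicative (ResidueField R)) :=
  ((squareUnits R).subgroupOf (higherUnits π n)).map (higherUnitsResidue hπ hn)

theorem relIndex_squareUnits_sup_higherUnits_succ (hπ : Irreducible π) {n : ℕ} (hn : n ≠ 0) :
    (squareUnits R ⊔ higherUnits π (n + 1)).relIndex (higherUnits π n) =
      (squareResidues hπ hn).index := by
  rw [← Subgroup.index_comap_of_surjective _ (higherUnitsResidue_surjective hπ hn), squareResidues,
    Subgroup.comap_map_eq, higherUnitsResidue_ker, Subgroup.relIndex]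
  congr 1
  ext u
  simp only [Subgroup.mem_subgroupOf, Subgroup.mem_sup, Subgroup.mem_subgroupOf]
  constructor
  · rintro ⟨s, hs, w, hw, h⟩
    have hw' := higherUnits_succ_le π n hw
    refine ⟨⟨s, ?_⟩, hs, ⟨w, hw'⟩, hw, Subtype.ext h⟩
    rw [eq_mul_inv_of_mul_eq h]
    exact mul_mem u.2 (inv_mem hw')
  · rintro ⟨s, hs, w, hw, rfl⟩
    exact ⟨s, hs, w, hw, rfl⟩

theorem mem_squareResidues (hπ : Irreducible π) {n : ℕ} (hn : n ≠ 0)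
    {x : Multiplicative (ResidueField R)} :
    x ∈ squareResidues hπ hn ↔
      ∃ d c : R, IsUnit (1 + d) ∧ d ^ 2 + 2 * d = π ^ n * c ∧ .ofAdd (residue R c) = x := by
  constructor
  · rintro ⟨u, ⟨s, hs⟩, rfl⟩
    obtain ⟨c, hc⟩ := mem_higherUnits.1 u.2
    refine ⟨(s : R) - 1, c, by simp, ?_,
      (higherUnitsResidue_apply hπ hn (sub_eq_iff_eq_add'.1 hc)).symm⟩
    have hs' : (s : R) ^ 2 = ((u : Rˣ) : R) := by
      simpa using congrArg Units.val hs
    rw [← hc, ← hs']; ring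
  · rintro ⟨d, c, ⟨s, hs⟩, h, rfl⟩
    have hs' : ((s ^ 2 : Rˣ) : R) = 1 + π ^ n * c := by
      rw [Units.val_pow_eq_pow_val, hs, ← h]; ring
    exact ⟨⟨s ^ 2, mem_higherUnits.2 ⟨c, by rw [hs']; ring⟩⟩, ⟨s, rfl⟩,
      higherUnitsResidue_apply hπ hn hs'⟩

variable {w : R} {e : ℕ}

theorem squareResidues_of_odd (hπ : Irreducible π) (h2 : (2 : R) = w * π ^ e) {n : ℕ}
    (hn : n ≠ 0) (hodd : Odd n) (hlt : n < 2 * e) : squareResidues hπ hn = ⊥ := by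
  rw [eq_bot_iff]
  intro x hx
  obtain ⟨d, c, -, h, rfl⟩ := (mem_squareResidues hπ hn).1 hx
  obtain ⟨j, rfl⟩ := hodd
  obtain ⟨a, rfl⟩ := hπ.prime.pow_succ_dvd_of_dvd_sq_add h2 (by omega) ⟨c, h⟩
  obtain ⟨e, rfl⟩ := Nat.exists_eq_add_of_lt (show j < e by omega)
  rw [Subgroup.mem_bot, ofAdd_eq_one, hπ.residue_eq_zero_iff_dvd]
  refine ⟨a ^ 2 + w * π ^ e * a, mul_left_cancel₀ (pow_ne_zero (2 * j + 1) hπ.ne_zero) ?_⟩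
  rw [← h, h2]; ring

theorem residueField_charTwo (hπ : Irreducible π) (h2 : (2 : R) = w * π ^ e) (he : e ≠ 0) :
    CharP (ResidueField R) 2 :=
  CharTwo.of_one_ne_zero_of_two_eq_zero one_ne_zero (by
    rw [← map_ofNat (residue R) 2, hπ.residue_eq_zero_iff_dvd, h2]
    exact (dvd_pow_self π he).mul_left w)

theorem exists_residue_eq_sq [Finite (ResidueField R)] [CharP (ResidueField R) 2]
    (x : ResidueField R) : ∃ a : R, residue R (a ^ 2) = x := by
  obtain ⟨y, rfl⟩ := FiniteField.isSquare_of_char_two (ringChar.eq (ResidueField R) 2) x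
  obtain ⟨a, rfl⟩ := residue_surjective y
  exact ⟨a, by rw [map_pow, sq]⟩

theorem squareResidues_of_even [Finite (ResidueField R)] (hπ : Irreducible π)
    (h2 : (2 : R) = w * π ^ e) {n : ℕ} (hn : n ≠ 0) (heven : Even n) (hlt : n < 2 * e) :
    squareResidues hπ hn = ⊤ := by
  have := residueField_charTwo hπ h2 (by omega)
  rw [eq_top_iff]
  rintro x -
  obtain ⟨a, ha⟩ := exists_residue_eq_sq x.toAdd
  obtain ⟨m, rfl⟩ := heven
  obtain ⟨e, rfl⟩ := Nat.exists_eq_add_of_lt (show m < e by omega)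
  refine (mem_squareResidues hπ hn).2 ⟨π ^ m * a, a ^ 2 + π * (w * π ^ e * a),
    hπ.isUnit_one_add_pow_mul (by omega) a, by rw [h2]; ring, ?_⟩
  rw [map_add, hπ.residue_eq_zero_iff_dvd.2 (dvd_mul_right π _), add_zero, ha, ofAdd_toAdd]

theorem squareResidues_of_lt (hπ : Irreducible π) (h2 : (2 : R) = w * π ^ e) (hw : IsUnit w)
    {n : ℕ} (hn : n ≠ 0) (hlt : 2 * e < n) : squareResidues hπ hn = ⊤ := by
  rw [eq_top_iff]
  rintro x -
  obtain ⟨c, hc⟩ := residue_surjective x.toAdd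
  obtain ⟨a, rfl⟩ := hw.dvd (a := c)
  obtain ⟨m, rfl⟩ := Nat.exists_eq_add_of_lt hlt
  refine (mem_squareResidues hπ hn).2 ⟨π ^ (e + m + 1) * a, w * a + π * (π ^ m * a ^ 2),
    hπ.isUnit_one_add_pow_mul (by omega) a, by rw [h2]; ring, ?_⟩
  rw [map_add, hπ.residue_eq_zero_iff_dvd.2 (dvd_mul_right π _), add_zero, hc, ofAdd_toAdd]

/-- In characteristic two, the additive map `x ↦ x ^ 2 + b * x`. -/
def sqAddMulHom {k : Type*} [CommRing k] [CharP k 2] (b : k) : k →+ k where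
  toFun x := x ^ 2 + b * x
  map_zero' := by simp
  map_add' x y := by rw [CharTwo.add_sq]; ring

theorem index_range_sqAddMulHom {k : Type*} [Field k] [Finite k] [CharP k 2] {b : k}
    (hb : b ≠ 0) : (sqAddMulHom b).range.index = 2 := by
  rw [AddSubgroup.index_range]
  have : ((sqAddMulHom b).ker : Set k) = {0, b} := by
    ext x
    rw [SetLike.mem_coe, AddMonoidHom.mem_ker]
    change x ^ 2 + b * x = 0 ↔ x = 0 ∨ x = b
    rw [sq, ← add_mul, mul_eq_zero, CharTwo.add_eq_zero, or_comm]
  rw [← SetLike.coe_sort_coe, this, Nat.card_coe_set_eq, Set.ncard_pair hb.symm]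

theorem index_squareResidues_two_mul [Finite (ResidueField R)] (hπ : Irreducible π)
    (h2 : (2 : R) = w * π ^ e) (hw : IsUnit w) (hn : 2 * e ≠ 0) :
    (squareResidues hπ hn).index = 2 := by
  have he : e ≠ 0 := by omega
  have := residueField_charTwo hπ h2 he
  refine Eq.trans ?_ (index_range_sqAddMulHom ((residue_ne_zero_iff_isUnit w).2 hw))
  rw [← AddSubgroup.index_toSubgroup]
  congr 1
  ext x
  rw [mem_squareResidues]
  constructor
  · rintro ⟨d, c, -, h, rfl⟩
    obtain ⟨m, rfl⟩ := Nat.exists_eq_add_one_of_ne_zero he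
    obtain ⟨a, rfl⟩ := hπ.prime.pow_succ_dvd_of_dvd_sq_add h2 m.lt_succ_self
      ((pow_dvd_pow π (by omega)).trans ⟨c, h⟩)
    refine ⟨residue R a, ?_⟩
    change residue R a ^ 2 + residue R w * residue R a = residue R c
    rw [← map_pow, ← map_mul, ← map_add]
    refine hπ.residue_eq_of_pow_mul_eq (n := 2 * (m + 1)) ?_
    rw [← h, h2]; ring
  · rintro ⟨y, hy⟩
    obtain ⟨a, rfl⟩ := residue_surjective y
    refine ⟨π ^ e * a, a ^ 2 + w * a, hπ.isUnit_one_add_pow_mul he a, by rw [h2]; ring, ?_⟩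
    rw [map_add, map_pow, map_mul]
    exact hy

theorem squareUnits_sup_higherUnits_one [Finite (ResidueField R)] [CharP (ResidueField R) 2]
    (hπ : Irreducible π) : squareUnits R ⊔ higherUnits π 1 = ⊤ := by
  rw [eq_top_iff]
  rintro u -
  obtain ⟨a, ha⟩ := exists_residue_eq_sq (residue R (u : R))
  have hs : IsUnit a := by
    rw [← isUnit_pow_iff two_ne_zero, ← residue_ne_zero_iff_isUnit, ha,
      residue_ne_zero_iff_isUnit]
    exact u.isUnit
  obtain ⟨s, rfl⟩ := hs
  refine Subgroup.mem_sup.2 ⟨s ^ 2, ⟨s, rfl⟩, (s ^ 2)⁻¹ * u, ?_, by simp⟩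
  have h : π ∣ (u : R) - (s : R) ^ 2 := by
    rw [← hπ.residue_eq_zero_iff_dvd, map_sub, ha, sub_self]
  rw [mem_higherUnits, pow_one]
  convert h.mul_left (((s ^ 2)⁻¹ : Rˣ) : R) using 1
  rw [mul_sub, ← Units.val_pow_eq_pow_val, Units.inv_mul, Units.val_mul]

theorem index_squareUnits_sup_higherUnits [Finite (ResidueField R)] (hπ : Irreducible π)
    (h2 : (2 : R) = w * π ^ e) (hw : IsUnit w) (he : e ≠ 0) {v : ℕ} (hv : 1 ≤ v) :
    (squareUnits R ⊔ higherUnits π v).index =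
      if v ≤ 2 * e then Nat.card (ResidueField R) ^ (v / 2)
      else 2 * Nat.card (ResidueField R) ^ e := by
  have := residueField_charTwo hπ h2 he
  induction v, hv using Nat.le_induction with
  | base =>
    rw [squareUnits_sup_higherUnits_one hπ, Subgroup.index_top, if_pos (by omega)]
    simp
  | succ n hn ih =>
    have hn0 : n ≠ 0 := by omega
    rw [index_squareUnits_sup_higherUnits_succ, relIndex_squareUnits_sup_higherUnits_succ hπ hn0,
      ih]
    rcases lt_trichotomy n (2 * e) with h | rfl | h
    · rw [if_pos h.le, if_pos (Nat.succ_le_of_lt h)]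
      rcases Nat.even_or_odd n with hp | hp
      · rw [squareResidues_of_even hπ h2 hn0 hp h, Subgroup.index_top, one_mul]
        congr 1
        obtain ⟨m, rfl⟩ := hp
        omega
      · rw [squareResidues_of_odd hπ h2 hn0 hp h, Subgroup.index_bot,
          Nat.card_congr Multiplicative.toAdd, ← pow_succ']
        congr 1
        obtain ⟨m, rfl⟩ := hp
        omega
    · rw [index_squareResidues_two_mul hπ h2 hw, if_pos le_rfl, if_neg (by omega)]
      congr 2
      omega
    · rw [squareResidues_of_lt hπ h2 hw hn0 h, Subgroup.index_top, one_mul, if_neg (by omega),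
        if_neg (by omega)]

end UnitFiltration

section AdicCompletion

namespace IsDedekindDomain.HeightOneSpectrum

open WithZero

variable {A : Type*} [CommRing A] [IsDedekindDomain A] {K : Type*} [Field K] [Algebra A K]
  [IsFractionRing A K] {𝔭 : HeightOneSpectrum A}

theorem pow_dvd_iff_valued_le {π : 𝔭.adicCompletionIntegers K}
    (hπ : Valued.v (π : 𝔭.adicCompletion K) = exp (-1 : ℤ)) {n : ℕ}
    {x : 𝔭.adicCompletionIntegers K} :
    π ^ n ∣ x ↔ Valued.v (x : 𝔭.adicCompletion K) ≤ exp (-(n : ℤ)) := by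
  have hn : Valued.v ((π ^ n : 𝔭.adicCompletionIntegers K) : 𝔭.adicCompletion K) =
      exp (-(n : ℤ)) := by
    rw [SubmonoidClass.coe_pow, map_pow, hπ, ← exp_nsmul]; simp
  rw [← hn]
  exact ((adicCompletionIntegers.integers K 𝔭).le_iff_dvd).symm

theorem mem_maximalIdeal_adicCompletionIntegers_iff {x : 𝔭.adicCompletionIntegers K} :
    x ∈ maximalIdeal (𝔭.adicCompletionIntegers K) ↔ Valued.v (x : 𝔭.adicCompletion K) < 1 := by
  have hx : Valued.v (x : 𝔭.adicCompletion K) ≤ 1 := x.2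
  rw [mem_maximalIdeal, mem_nonunits_iff, adicCompletionIntegers.isUnit_iff_valued_eq_one,
    hx.lt_iff_ne]

theorem exists_irreducible_valued_eq (K : Type*) [Field K] [Algebra A K] [IsFractionRing A K]
    (𝔭 : HeightOneSpectrum A) : ∃ π : 𝔭.adicCompletionIntegers K,
      Irreducible π ∧ Valued.v (π : 𝔭.adicCompletion K) = exp (-1 : ℤ) := by
  obtain ⟨π, hπ⟩ : ∃ π : 𝔭.adicCompletionIntegers K,
      Valued.v (π : 𝔭.adicCompletion K) = exp (-1 : ℤ) := by
    obtain ⟨x, hx⟩ := valuedAdicCompletion_surjective K 𝔭 (exp (-1 : ℤ))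
    refine ⟨⟨x, (mem_adicCompletionIntegers A K 𝔭).2 (hx.le.trans ?_)⟩, hx⟩
    rw [← exp_zero, exp_le_exp]
    norm_num
  refine ⟨π, (IsDiscreteValuationRing.irreducible_iff_uniformizer π).2 (Ideal.ext fun y => ?_), hπ⟩
  rw [Ideal.mem_span_singleton, mem_maximalIdeal_adicCompletionIntegers_iff, ← pow_one π,
    pow_dvd_iff_valued_le hπ, ← lt_mul_exp_iff_le exp_ne_zero, ← exp_add]
  simp

theorem card_residueField_adicCompletionIntegers (K : Type*) [Field K] [Algebra A K]
    [IsFractionRing A K] (𝔭 : HeightOneSpectrum A) :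
    Nat.card (ResidueField (𝔭.adicCompletionIntegers K)) = Nat.card (A ⧸ 𝔭.asIdeal) := by
  let φ : A →+* ResidueField (𝔭.adicCompletionIntegers K) :=
    (residue _).comp (algebraMap A (𝔭.adicCompletionIntegers K))
  have hker : RingHom.ker φ = 𝔭.asIdeal := by
    ext a
    rw [RingHom.mem_ker, RingHom.comp_apply, residue_eq_zero_iff,
      mem_maximalIdeal_adicCompletionIntegers_iff,
      algebraMap_adicCompletionIntegers_apply, valuedAdicCompletion_eq_valuation',
      valuation_lt_one_iff_mem]
  have hsurj : Function.Surjective φ := by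
    intro y
    obtain ⟨x, rfl⟩ := residue_surjective y
    obtain ⟨k, hk⟩ : ∃ k : K, Valued.v ((k : 𝔭.adicCompletion K) - x) < 1 := by
      obtain ⟨k, hk⟩ := DenseRange.exists_mem_open (denseRange_algebraMap K 𝔭)
        ((Valued.isOpen_ball _ 1).preimage (continuous_sub_right (x : 𝔭.adicCompletion K)))
        ⟨x, by simp⟩
      have hk' : Valued.v (algebraMap K (𝔭.adicCompletion K) k - x) < 1 := by simpa using hk
      exact ⟨k, hk'⟩
    have hk1 : 𝔭.valuation K k ≤ 1 := by
      rw [← valuedAdicCompletion_eq_valuation', ← sub_add_cancel (k : 𝔭.adicCompletion K) x]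
      exact (Valued.v.map_add _ _).trans (max_le hk.le x.2)
    obtain ⟨a, ha⟩ := exists_valuation_sub_lt_of_integer 𝔭 hk1 1
    refine ⟨a, ?_⟩
    rw [← sub_eq_zero, RingHom.comp_apply, ← map_sub, residue_eq_zero_iff,
      mem_maximalIdeal_adicCompletionIntegers_iff]
    have hsub : (((algebraMap A (𝔭.adicCompletionIntegers K) a - x :
        𝔭.adicCompletionIntegers K)) : 𝔭.adicCompletion K) =
        ((algebraMap A K a - k : K) : 𝔭.adicCompletion K) + ((k : 𝔭.adicCompletion K) - x) := by
      rw [show ((algebraMap A K a - k : K) : 𝔭.adicCompletion K) =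
        (algebraMap A K a : 𝔭.adicCompletion K) - k from
          map_sub (algebraMap K (𝔭.adicCompletion K)) _ _, sub_add_sub_cancel]
      rfl
    rw [hsub]
    refine Valued.v.map_add_lt ?_ hk
    rw [valuedAdicCompletion_eq_valuation']
    simpa using ha
  rw [← hker]
  exact (Nat.card_congr (RingHom.quotientKerEquivOfSurjective hsurj).toEquiv).symm

end IsDedekindDomain.HeightOneSpectrum

end AdicCompletion

theorem stmt19 (K : Type) [Field K] [NumberField K] (htr : TotallyReal K)
    (𝔭 : HeightOneSpectrum (𝓞 K)) (hdyadic : (2 : 𝓞 K) ∈ 𝔭.asIdeal)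
    (e f : ℕ)
    (he : Valued.v (2 : 𝔭.adicCompletion K) =
      ((Multiplicative.ofAdd (-(e : ℤ)) : Multiplicative ℤ) : WithZero (Multiplicative ℤ)))
    (hf : Nat.card (𝓞 K ⧸ 𝔭.asIdeal) = 2 ^ f)
    (v : ℕ) (hv : 1 ≤ v) :
    (Subgroup.closure
        ({x : (↥(𝔭.adicCompletionIntegers K))ˣ | ∃ u, x = u ^ 2} ∪
          {u : (↥(𝔭.adicCompletionIntegers K))ˣ |
            Valued.v (((u : ↥(𝔭.adicCompletionIntegers K)) : 𝔭.adicCompletion K) - 1) ≤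
              ((Multiplicative.ofAdd (-(v : ℤ)) : Multiplicative ℤ) :
                WithZero (Multiplicative ℤ))})).index =
      if v ≤ 2 * e then 2 ^ ((v / 2) * f) else 2 ^ (e * f + 1) := by
  obtain ⟨π, hπ, hvπ⟩ := HeightOneSpectrum.exists_irreducible_valued_eq K 𝔭
  have he' : Valued.v ((2 : 𝔭.adicCompletionIntegers K) : 𝔭.adicCompletion K) =
      WithZero.exp (-(e : ℤ)) := he
  obtain ⟨w, hw⟩ := (HeightOneSpectrum.pow_dvd_iff_valued_le hvπ).2 he'.le
  have hwu : IsUnit w := by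
    rw [HeightOneSpectrum.adicCompletionIntegers.isUnit_iff_valued_eq_one]
    have h := he'
    rw [hw, MulMemClass.coe_mul, SubmonoidClass.coe_pow, map_mul, map_pow, hvπ,
      ← WithZero.exp_nsmul, nsmul_eq_mul, mul_neg_one] at h
    exact mul_left_cancel₀ WithZero.exp_ne_zero (h.trans (mul_one _).symm)
  have he0 : e ≠ 0 := by
    rintro rfl
    have h : Valued.v (2 : 𝔭.adicCompletion K) < 1 := by
      rw [← map_ofNat (algebraMap K (𝔭.adicCompletion K)) 2]
      refine (HeightOneSpectrum.valuedAdicCompletion_eq_valuation' 𝔭 (2 : K)).trans_lt ?_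
      rw [← map_ofNat (algebraMap (𝓞 K) K) 2]
      exact (𝔭.valuation_lt_one_iff_mem 2).2 hdyadic
    rw [he] at h
    simp at h
  have hcard : Nat.card (ResidueField (𝔭.adicCompletionIntegers K)) = 2 ^ f :=
    (HeightOneSpectrum.card_residueField_adicCompletionIntegers K 𝔭).trans hf
  have : Finite (ResidueField (𝔭.adicCompletionIntegers K)) :=
    Nat.finite_of_card_ne_zero (by rw [hcard]; positivity)
  have hsq : {x : (𝔭.adicCompletionIntegers K)ˣ | ∃ u, x = u ^ 2} =
      (squareUnits (𝔭.adicCompletionIntegers K) : Set _) := by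
    ext x
    exact exists_congr fun u => eq_comm
  have hhigher : {u : (𝔭.adicCompletionIntegers K)ˣ |
      Valued.v (((u : 𝔭.adicCompletionIntegers K) : 𝔭.adicCompletion K) - 1) ≤
        ((Multiplicative.ofAdd (-(v : ℤ)) : Multiplicative ℤ) : WithZero (Multiplicative ℤ))} =
      (higherUnits π v : Set _) := by
    ext u
    exact (mem_higherUnits.trans (HeightOneSpectrum.pow_dvd_iff_valued_le hvπ)).symm
  rw [hsq, hhigher, Subgroup.closure_union, Subgroup.closure_eq, Subgroup.closure_eq,
    index_squareUnits_sup_higherUnits hπ (hw.trans (mul_comm _ _)) hwu he0 hv, hcard,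
    ← pow_mul, ← pow_mul, mul_comm f, mul_comm f, pow_succ']
end
end
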